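/- arXiv:math/0503412 — 8 statements merged into one kernel-verified Lean document; each statement's English description precedes it below -/
import Mathlib

section
/- Suppose x, y ∈ k satisfy y² = (x−p₁)(x−p₁+2)((2p₁−3)x−p₁+2)·g(x) and g(x) ≠ 0. Set X = λ(x−p₁)x²/g(x) and Y = λ(λ−1)·y·x·(x−1)/g(x)². Then Y² = X·(X−1)·(X−λ); that is, (X, Y) is a point of the Legendre elliptic curve E: Y² = X(X−1)(X−λ). (This is the content of Proposition 1.1: the maps f± : C → E given by these formulas are well-defined covers of degree 3.) -/
/-- If y² = (x−p₁)(x−p₁+2)((2p₁−3)x−p₁+2)·g(x) and g(x) ≠ 0, then with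
X = λ(x−p₁)x²/g(x) and Y = λ(λ−1)yx(x−1)/g(x)², one has Y² = X(X−1)(X−λ). -/
theorem stmt_0 {k : Type*} [Field k] (h2 : (2 : k) ≠ 0) (h3 : (3 : k) ≠ 0)
    (lam : k) (hlam0 : lam ≠ 0) (hlam1 : lam ≠ 1) (p₁ : k)
    (g : k → k)
    (hg : ∀ t : k, g t = t ^ 3 - p₁ * t ^ 2 + (-2 * lam * p₁ + 2 * p₁ + 3 * lam - 3) * t
      - (1 - lam) * (p₁ - 2))
    (x y : k)
    (hy : y ^ 2 = (x - p₁) * (x - p₁ + 2) * ((2 * p₁ - 3) * x - p₁ + 2) * g x)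
    (hgx : g x ≠ 0) :
    (lam * (lam - 1) * y * x * (x - 1) / (g x) ^ 2) ^ 2 =
      (lam * (x - p₁) * x ^ 2 / g x) * (lam * (x - p₁) * x ^ 2 / g x - 1)
        * (lam * (x - p₁) * x ^ 2 / g x - lam) := by
  have hX₁ : lam * (x - p₁) * x ^ 2 / g x - 1
      = (lam - 1) * (x - 1) ^ 2 * (x - p₁ + 2) / g x := by
    rw [div_sub_one hgx]
    congr 1
    rw [hg]
    ring
  have hXlam : lam * (x - p₁) * x ^ 2 / g x - lam
      = lam * (lam - 1) * ((2 * p₁ - 3) * x - p₁ + 2) / g x := by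
    rw [div_sub' hgx]
    congr 1
    rw [hg]
    ring
  have hY : (lam * (lam - 1) * y * x * (x - 1) / (g x) ^ 2) ^ 2
      = (lam * (lam - 1) * x * (x - 1)) ^ 2 * y ^ 2 / (g x) ^ 4 := by
    rw [div_pow]
    ring
  rw [hX₁, hXlam, hY, hy]
  generalize g x = c at hgx
  field_simp
end

section
/- If p₁ ≠ 1, p₁ ≠ 2, and g(X) is squarefree in k[X], then the degree-6 polynomial h(X) = (X−p₁)·(X−p₁+2)·((2p₁−3)X−p₁+2)·g(X) is squarefree in k[X]. (This is the smoothness claim of Proposition 1.1: the curve y² = h(x) is a smooth curve of genus 2 when the cover u is unramified over ∞.) -/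
open Polynomial

theorem isCoprime_X_sub_C_of_eval_ne_zero {k : Type*} [Field k] {r : k} {f : k[X]}
    (h : f.eval r ≠ 0) : IsCoprime (X - C r) f :=
  (irreducible_X_sub_C r).coprime_iff_not_dvd.2 fun hd => h (dvd_iff_isRoot.1 hd)

theorem squarefree_C_mul_X_sub_C {k : Type*} [Field k] {a b : k} (hb : b ≠ 0) :
    Squarefree (C a * X - C b) := by
  refine Separable.squarefree ⟨-C b⁻¹, C b⁻¹ * X, ?_⟩
  have hC : C b⁻¹ * C b = 1 := by rw [← C_mul, inv_mul_cancel₀ hb, C_1]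
  simp only [derivative_sub, derivative_mul, derivative_C, derivative_X]
  linear_combination hC

/-- If p₁ ≠ 1, p₁ ≠ 2 and g is squarefree, then
h(X) = (X−p₁)(X−p₁+2)((2p₁−3)X−p₁+2)·g(X) is squarefree in k[X]. -/
theorem stmt_1 {k : Type*} [Field k] (h2 : (2 : k) ≠ 0) (h3 : (3 : k) ≠ 0)
    (lam : k) (hlam0 : lam ≠ 0) (hlam1 : lam ≠ 1) (p₁ : k)
    (g : k[X])
    (hg : g = X ^ 3 - C p₁ * X ^ 2 + C (-2 * lam * p₁ + 2 * p₁ + 3 * lam - 3) * X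
      - C ((1 - lam) * (p₁ - 2)))
    (hp1 : p₁ ≠ 1) (hp2 : p₁ ≠ 2) (hsq : Squarefree g) :
    Squarefree ((X - C p₁) * (X - C p₁ + C 2) * (C (2 * p₁ - 3) * X - C p₁ + C 2) * g) := by
  have hp1' : p₁ - 1 ≠ 0 := sub_ne_zero.2 hp1
  have hp2' : p₁ - 2 ≠ 0 := sub_ne_zero.2 hp2
  have hlam1' : 1 - lam ≠ 0 := sub_ne_zero.2 hlam1.symm
  have e1 : X - C p₁ + C 2 = X - C (p₁ - 2) := by rw [C_sub]; ring
  have e2 : C (2 * p₁ - 3) * X - C p₁ + C 2 = C (2 * p₁ - 3) * X - C (p₁ - 2) := by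
    rw [C_sub (a := p₁)]; ring
  rw [e1, e2]
  set L : k[X] := C (2 * p₁ - 3) * X - C (p₁ - 2) with hL
  have hgL : g = X ^ 2 * (X - C p₁) + C (1 - lam) * L := by
    rw [hg, hL]
    simp only [map_sub, map_add, map_mul, map_neg, C_1]
    simp only [map_ofNat]
    ring
  have h12 : IsCoprime (X - C p₁) (X - C (p₁ - 2)) := by
    apply isCoprime_X_sub_C_of_eval_ne_zero
    simpa using h2
  have h1L : IsCoprime (X - C p₁) L := by
    apply isCoprime_X_sub_C_of_eval_ne_zero
    have : L.eval p₁ = 2 * (p₁ - 1) ^ 2 := by simp [hL]; ring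
    rw [this]; positivity
  have h2L : IsCoprime (X - C (p₁ - 2)) L := by
    apply isCoprime_X_sub_C_of_eval_ne_zero
    have : L.eval (p₁ - 2) = 2 * (p₁ - 2) ^ 2 := by simp [hL]; ring
    rw [this]; positivity
  have hXL : IsCoprime X L := by
    have : IsCoprime (X - C 0) L := by
      apply isCoprime_X_sub_C_of_eval_ne_zero
      simpa [hL, sub_eq_zero] using hp2.symm
    simpa using this
  have h1g : IsCoprime (X - C p₁) g := by
    apply isCoprime_X_sub_C_of_eval_ne_zero
    have : g.eval p₁ = 2 * (1 - lam) * (p₁ - 1) ^ 2 := by simp [hg]; ring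
    rw [this]; positivity
  have h2g : IsCoprime (X - C (p₁ - 2)) g := by
    apply isCoprime_X_sub_C_of_eval_ne_zero
    have : g.eval (p₁ - 2) = -(2 * lam * (p₁ - 2) ^ 2) := by simp [hg]; ring
    rw [this, neg_ne_zero]; positivity
  have hLg : IsCoprime L g := by
    rw [hgL, IsCoprime.add_mul_right_right_iff]
    exact (hXL.symm.pow_right).mul_right h1L.symm
  rw [squarefree_mul_iff, squarefree_mul_iff, squarefree_mul_iff]
  exact ⟨((h1g.mul_left h2g).mul_left hLg).isRelPrime,
    ⟨(h1L.mul_left h2L).isRelPrime, ⟨h12.isRelPrime, (irreducible_X_sub_C _).squarefree,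
      (irreducible_X_sub_C _).squarefree⟩, squarefree_C_mul_X_sub_C hp2'⟩, hsq⟩
end

section
/- In the polynomial ring k[X] the identity λ·(X−p₁)·X² · (λ·(X−p₁)·X² − g(X)) · (λ·(X−p₁)·X² − λ·g(X)) = λ²·(λ−1)²·X²·(X−1)²·(X−p₁)·(X−p₁+2)·((2p₁−3)·X−p₁+2) holds. (This is the key identity behind Proposition 1.1: with X₁ = λ(X−p₁)X² and X₀ = g(X), the product X₁·(X₁−X₀)·(X₁−λX₀) equals λ²(λ−1)²X²(X−1)² times the sextic defining the genus 2 curve divided by g.) -/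
open Polynomial

/-- λ(X−p₁)X² · (λ(X−p₁)X² − g) · (λ(X−p₁)X² − λg)
= λ²(λ−1)²X²(X−1)²(X−p₁)(X−p₁+2)((2p₁−3)X−p₁+2) in k[X]. -/
theorem stmt_4 {k : Type*} [Field k] (h2 : (2 : k) ≠ 0) (h3 : (3 : k) ≠ 0)
    (lam : k) (hlam0 : lam ≠ 0) (hlam1 : lam ≠ 1) (p₁ : k)
    (g : k[X])
    (hg : g = X ^ 3 - C p₁ * X ^ 2 + C (-2 * lam * p₁ + 2 * p₁ + 3 * lam - 3) * X
      - C ((1 - lam) * (p₁ - 2))) :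
    (C lam * (X - C p₁) * X ^ 2) * (C lam * (X - C p₁) * X ^ 2 - g)
        * (C lam * (X - C p₁) * X ^ 2 - C lam * g) =
      C (lam ^ 2 * (lam - 1) ^ 2) * X ^ 2 * (X - C 1) ^ 2 * (X - C p₁) * (X - C p₁ + C 2)
        * (C (2 * p₁ - 3) * X - C p₁ + C 2) := by
  subst hg
  simp only [map_mul, map_add, map_sub, map_neg, map_pow, map_one, map_ofNat]
  ring
end

section
/- Let g̃(X) = X³ + g₂X² + g₁X + g₀ ∈ k[X] be a monic cubic and let p₁, p₂ ∈ k. Assume: (i) g̃(1) = λ·(1−p₁); (ii) λ·(X−p₁)·X² − g̃(X) = (λ−1)·(X−p₂)·(X−1)² in k[X]; (iii) the coefficient of X² in λ·(X−p₁)·X² − λ·g̃(X) is zero. Then g̃ is completely determined by p₁ and λ, namely g₂ = −p₁, g₁ = −2λp₁ + 2p₁ + 3λ − 3 and g₀ = (λ−1)·(p₁−2), so that g̃(X) = X³ − p₁X² + (−2λp₁+2p₁+3λ−3)X − (1−λ)(p₁−2). (Equations (10), (11) and (14) of the paper: the cover u is completely determined by p₁ and λ.) -/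
open Polynomial

/-- The coefficients of a vanishing polynomial of degree at most two vanish. -/
theorem quadratic_coeffs_eq_zero {R : Type*} [Semiring R] {a b c : R}
    (h : C a * X ^ 2 + C b * X + C c = 0) : a = 0 ∧ b = 0 ∧ c = 0 := by
  refine ⟨?_, ?_, ?_⟩
  · simpa [coeff_X, coeff_C] using congrArg (fun p => coeff p 2) h
  · simpa [coeff_X_pow, coeff_C] using congrArg (fun p => coeff p 1) h
  · simpa using congrArg (fun p => coeff p 0) h

/-- Under the same hypotheses as Statement 5, g̃ is completely determined
by p₁ and λ: g₂ = −p₁, g₁ = −2λp₁+2p₁+3λ−3, g₀ = (λ−1)(p₁−2), i.e.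
g̃(X) = X³ − p₁X² + (−2λp₁+2p₁+3λ−3)X − (1−λ)(p₁−2). -/
theorem stmt_6 {k : Type*} [Field k] (h2 : (2 : k) ≠ 0) (h3 : (3 : k) ≠ 0)
    (lam : k) (hlam0 : lam ≠ 0) (hlam1 : lam ≠ 1)
    (g₂ g₁ g₀ p₁ p₂ : k) (gt : k[X])
    (hgt : gt = X ^ 3 + C g₂ * X ^ 2 + C g₁ * X + C g₀)
    (h1 : gt.eval 1 = lam * (1 - p₁))
    (h2' : C lam * (X - C p₁) * X ^ 2 - gt = C (lam - 1) * (X - C p₂) * (X - C 1) ^ 2)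
    (h3' : (C lam * (X - C p₁) * X ^ 2 - C lam * gt).coeff 2 = 0) :
    g₂ = -p₁ ∧ g₁ = -2 * lam * p₁ + 2 * p₁ + 3 * lam - 3 ∧ g₀ = (lam - 1) * (p₁ - 2) ∧
      gt = X ^ 3 - C p₁ * X ^ 2 + C (-2 * lam * p₁ + 2 * p₁ + 3 * lam - 3) * X
        - C ((1 - lam) * (p₁ - 2)) := by
  subst hgt
  have hzero : C (-lam * p₁ - g₂ + (lam - 1) * (p₂ + 2)) * X ^ 2 +
      C (-g₁ - (lam - 1) * (2 * p₂ + 1)) * X + C (-g₀ + (lam - 1) * p₂) = 0 := by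
    simp only [map_sub, map_add, map_mul, map_neg, map_one, map_ofNat] at h2' ⊢
    linear_combination h2'
  obtain ⟨e₂, e₁, e₀⟩ := quadratic_coeffs_eq_zero hzero
  have hcoeff : lam * (-p₁ - g₂) = 0 := by
    have hexp : C lam * (X - C p₁) * X ^ 2 -
        C lam * (X ^ 3 + C g₂ * X ^ 2 + C g₁ * X + C g₀) =
        C (lam * (-p₁ - g₂)) * X ^ 2 + C (-lam * g₁) * X + C (-lam * g₀) := by
      simp only [map_sub, map_mul, map_neg]
      ring
    rw [hexp] at h3'
    simpa only [coeff_add, coeff_C_mul, coeff_X_pow_self, coeff_X_of_ne_one (n := 2) (by decide),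
      coeff_C_of_ne_zero (n := 2) (by decide), mul_one, mul_zero, add_zero] using h3'
  have hg₂ : g₂ = -p₁ := by
    linear_combination -(mul_eq_zero.mp hcoeff).resolve_left hlam0
  have hp₂ : p₂ = p₁ - 2 :=
    mul_left_cancel₀ (sub_ne_zero.mpr hlam1) (by linear_combination e₂ + hg₂)
  have hg₁ : g₁ = -2 * lam * p₁ + 2 * p₁ + 3 * lam - 3 := by
    linear_combination -e₁ - 2 * (lam - 1) * hp₂
  have hg₀ : g₀ = (lam - 1) * (p₁ - 2) := by
    linear_combination -e₀ + (lam - 1) * hp₂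
  refine ⟨hg₂, hg₁, hg₀, ?_⟩
  rw [hg₂, hg₁, hg₀]
  simp only [map_sub, map_add, map_mul, map_neg, map_one, map_ofNat]
  ring
end

section
/- The polynomials λ·(X−p₁)·X² and g(X) are coprime in k[X] if and only if p₁ ≠ 1 and p₁ ≠ 2. (Remark 2.2 of the paper: the rational map x ↦ λ(x−p₁)x²/g(x) has degree 3 if and only if g(p₁) ≠ 0 and g(0) ≠ 0, which holds if and only if p₁ ∉ {1, 2}.) -/
open Polynomial

theorem isCoprime_X_sub_C_iff_eval_ne_zero {k : Type*} [Field k] (a : k) (f : k[X]) :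
    IsCoprime (X - C a) f ↔ f.eval a ≠ 0 := by
  rw [(irreducible_X_sub_C a).coprime_iff_not_dvd, dvd_iff_isRoot, IsRoot.def]

/-- λ(X−p₁)X² and g(X) are coprime in k[X] iff p₁ ≠ 1 and p₁ ≠ 2. -/
theorem stmt_8 {k : Type*} [Field k] (h2 : (2 : k) ≠ 0) (h3 : (3 : k) ≠ 0)
    (lam : k) (hlam0 : lam ≠ 0) (hlam1 : lam ≠ 1) (p₁ : k)
    (g : k[X])
    (hg : g = X ^ 3 - C p₁ * X ^ 2 + C (-2 * lam * p₁ + 2 * p₁ + 3 * lam - 3) * X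
      - C ((1 - lam) * (p₁ - 2))) :
    IsCoprime (C lam * (X - C p₁) * X ^ 2) g ↔ p₁ ≠ 1 ∧ p₁ ≠ 2 := by
  have hlam : 1 - lam ≠ 0 := sub_ne_zero.mpr hlam1.symm
  have eval_p₁ : g.eval p₁ = 2 * (1 - lam) * (p₁ - 1) ^ 2 := by
    rw [hg]
    simp only [eval_sub, eval_add, eval_mul, eval_pow, eval_X, eval_C]
    ring
  have eval_zero : g.eval 0 = -((1 - lam) * (p₁ - 2)) := by
    rw [hg]
    simp only [eval_sub, eval_add, eval_mul, eval_pow, eval_X, eval_C]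
    ring
  have coprime_X : IsCoprime X g ↔ g.eval 0 ≠ 0 := by
    simpa using isCoprime_X_sub_C_iff_eval_ne_zero 0 g
  have hunit : IsUnit (C lam) := isUnit_C.mpr hlam0.isUnit
  rw [mul_assoc, isCoprime_mul_unit_left_left hunit, IsCoprime.mul_left_iff,
    IsCoprime.pow_left_iff two_pos, coprime_X, isCoprime_X_sub_C_iff_eval_ne_zero,
    eval_p₁, eval_zero]
  simp [h2, hlam, sub_eq_zero]
end

section
/- Let ζ, δ ∈ k with ζ ≠ λ, δ ≠ 0, p₁ ≠ 2 and 2p₁ − 3 ≠ 0. If (λ−ζ)·(2δp₁ − 3δ²) = −ζ·(1−λ)·(2p₁−3) and (2δ³ − p₁δ²)·(λ−ζ) = ζ·(1−λ)·(p₁−2) (equations (16) and (17) of the paper, obtained by comparing coefficients in λ(X−p₁)X² − ζg(X) = (λ−ζ)(X−p₁+2δ)(X−δ)²), then δ = 1 or δ = p₁·(p₁−2)/(2p₁−3). (The determination of the fourth ramification point of the cover u.) -/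
/-- If ζ ≠ λ, δ ≠ 0, p₁ ≠ 2, 2p₁−3 ≠ 0 and equations (16), (17) hold,
then δ = 1 or δ = p₁(p₁−2)/(2p₁−3). -/
theorem stmt_11 {k : Type*} [Field k] (h2 : (2 : k) ≠ 0) (h3 : (3 : k) ≠ 0)
    (lam : k) (hlam0 : lam ≠ 0) (hlam1 : lam ≠ 1) (p₁ : k)
    (ζ δ : k) (hzl : ζ ≠ lam) (hδ : δ ≠ 0) (hp2 : p₁ ≠ 2) (hp3 : 2 * p₁ - 3 ≠ 0)
    (h16 : (lam - ζ) * (2 * δ * p₁ - 3 * δ ^ 2) = -ζ * (1 - lam) * (2 * p₁ - 3))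
    (h17 : (2 * δ ^ 3 - p₁ * δ ^ 2) * (lam - ζ) = ζ * (1 - lam) * (p₁ - 2)) :
    δ = 1 ∨ δ = p₁ * (p₁ - 2) / (2 * p₁ - 3) := by
  have key : 2 * (lam - ζ) * δ * ((δ - 1) * (δ * (2 * p₁ - 3) - p₁ * (p₁ - 2))) = 0 := by
    linear_combination (p₁ - 2) * h16 + (2 * p₁ - 3) * h17
  have hne : 2 * (lam - ζ) * δ ≠ 0 :=
    mul_ne_zero (mul_ne_zero h2 (sub_ne_zero.mpr hzl.symm)) hδ
  rcases mul_eq_zero.mp ((mul_eq_zero.mp key).resolve_left hne) with h | h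
  · exact Or.inl (sub_eq_zero.mp h)
  · exact Or.inr ((eq_div_iff hp3).mpr (sub_eq_zero.mp h))
end

section
/- Assume 2p₁ − 3 ≠ 0 and set δ = p₁·(p₁−2)/(2p₁−3). Then λ·(δ−p₁)·δ² · ((λ−1)·(2p₁−3)³ + p₁³·(p₁−2)) = λ·p₁³·(p₁−2) · g(δ) in k. (Equation (18) of the paper: the fourth branch point of the cover u is ζ = λp₁³(p₁−2)/((λ−1)(2p₁−3)³ + p₁³(p₁−2)), stated here in cross-multiplied form.) -/
open Polynomial

/-- With δ = p₁(p₁−2)/(2p₁−3) (and 2p₁−3 ≠ 0),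
λ(δ−p₁)δ²·((λ−1)(2p₁−3)³ + p₁³(p₁−2)) = λp₁³(p₁−2)·g(δ). -/
theorem stmt_13 {k : Type*} [Field k] (h2 : (2 : k) ≠ 0) (h3 : (3 : k) ≠ 0)
    (lam : k) (hlam0 : lam ≠ 0) (hlam1 : lam ≠ 1) (p₁ : k)
    (g : k[X])
    (hg : g = X ^ 3 - C p₁ * X ^ 2 + C (-2 * lam * p₁ + 2 * p₁ + 3 * lam - 3) * X
      - C ((1 - lam) * (p₁ - 2)))
    (hp3 : 2 * p₁ - 3 ≠ 0) (δ : k) (hδ : δ = p₁ * (p₁ - 2) / (2 * p₁ - 3)) :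
    lam * (δ - p₁) * δ ^ 2 * ((lam - 1) * (2 * p₁ - 3) ^ 3 + p₁ ^ 3 * (p₁ - 2)) =
      lam * p₁ ^ 3 * (p₁ - 2) * g.eval δ := by
  have h : δ * (2 * p₁ - 3) = p₁ * (p₁ - 2) := by rw [hδ, div_mul_cancel₀ _ hp3]
  have h' : (δ - p₁) * (2 * p₁ - 3) = -(p₁ * (p₁ - 1)) := by linear_combination h
  have hprod : (δ - p₁) * δ ^ 2 * (2 * p₁ - 3) ^ 3 = -(p₁ ^ 3 * (p₁ - 2) ^ 2 * (p₁ - 1)) := by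
    calc (δ - p₁) * δ ^ 2 * (2 * p₁ - 3) ^ 3
        = ((δ - p₁) * (2 * p₁ - 3)) * (δ * (2 * p₁ - 3)) ^ 2 := by ring
      _ = -(p₁ ^ 3 * (p₁ - 2) ^ 2 * (p₁ - 1)) := by rw [h, h']; ring
  have heval : g.eval δ = (δ - p₁) * δ ^ 2 + (1 - lam) * (p₁ - 2) * (p₁ - 1) := by
    simp only [hg, eval_sub, eval_add, eval_mul, eval_pow, eval_X, eval_C]
    linear_combination (1 - lam) * h
  rw [heval]
  linear_combination lam * (lam - 1) * hprod
end

section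
/- The degree-4 polynomial Z(X) = (λ−1)·(2X−3)³ + X³·(X−2) ∈ k[X] is squarefree; equivalently, since k is algebraically closed, Z has exactly four distinct roots in k. (Remark 2.4 of the paper: exactly four values of p₁ produce a cover u with a fourth ramification point lying over ∞.) -/
open Polynomial

/-- Over an algebraically closed field, Z(X) = (λ−1)(2X−3)³ + X³(X−2)
is squarefree, equivalently it has exactly four distinct roots. -/
theorem stmt_16 {k : Type*} [Field k] [IsAlgClosed k] (h2 : (2 : k) ≠ 0) (h3 : (3 : k) ≠ 0)
    (lam : k) (hlam0 : lam ≠ 0) (hlam1 : lam ≠ 1)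
    (Z : k[X]) (hZ : Z = C (lam - 1) * (2 * X - 3) ^ 3 + X ^ 3 * (X - 2)) :
    Squarefree Z ∧ {x : k | Z.IsRoot x}.ncard = 4 := by
  have hdeg : Z.natDegree = 4 := by
    have h : Z = X ^ 4 + C (8 * (lam - 1) - 2) * X ^ 3 + C (-36 * (lam - 1)) * X ^ 2
        + C (54 * (lam - 1)) * X + C (-27 * (lam - 1)) := by
      rw [hZ]
      simp only [map_sub, map_mul, map_neg, map_ofNat]
      ring
    rw [h]
    compute_degree!
  have hZ0 : Z ≠ 0 := by
    rintro rfl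
    simp at hdeg
  have hsep : Z.Separable := by
    refine isCoprime_of_irreducible_dvd (fun h => hZ0 h.1) fun p hp hpZ hpZ' => ?_
    obtain ⟨x, hx⟩ := IsAlgClosed.exists_root p hp.degree_pos.ne'
    have e : Z.eval x = 0 := (hx.dvd hpZ)
    have e' : (derivative Z).eval x = 0 := (hx.dvd hpZ')
    rw [hZ] at e e'
    simp [derivative_pow] at e e'
    have f : 2 * (2 * x - 3) * (3 * (lam - 1) * (2 * x - 3) + x ^ 2) = 0 := by
      linear_combination e'
    rcases mul_eq_zero.1 f with f | f
    · have g := (mul_eq_zero.1 f).resolve_left h2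
      have : (3 : k) ^ 3 = 0 := by
        linear_combination (-16) * e + (16 * (lam - 1) * (2 * x - 3) ^ 2
          + 8 * x ^ 3 - 4 * x ^ 2 - 6 * x - 9) * g
      exact h3 (pow_eq_zero_iff (by norm_num) |>.1 this)
    · have g : (x * (x - 3)) ^ 2 = 0 := by
        linear_combination (-3) * e + (2 * x - 3) ^ 2 * f
      rcases mul_eq_zero.1 (pow_eq_zero_iff (by norm_num) |>.1 g) with g | g
      · subst g
        have : (3 : k) ^ 2 * (lam - 1) = 0 := by linear_combination -f
        exact (mul_ne_zero (pow_ne_zero 2 h3) (sub_ne_zero.2 hlam1)) this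
      · obtain rfl : x = 3 := sub_eq_zero.1 g
        have : (3 : k) ^ 2 * lam = 0 := by linear_combination f
        exact (mul_ne_zero (pow_ne_zero 2 h3) hlam0) this
  refine ⟨hsep.squarefree, ?_⟩
  have hset : {x : k | Z.IsRoot x} = Z.rootSet k := by
    ext x
    simp [mem_rootSet, hZ0]
  rw [hset, ← Nat.card_coe_set_eq, Nat.card_eq_fintype_card,
    card_rootSet_eq_natDegree hsep (by simpa using IsAlgClosed.splits Z), hdeg]
end
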